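/- arXiv:math/0212052 — 2 statements merged into one kernel-verified Lean document; each statement's English description precedes it below -/
import Mathlib

section
/- Let V be a finite-dimensional real vector space with dim V > 0. Then the restriction map {·,·} ↦ {·,·}|_{Aff(V,ℝ)×Aff(V,ℝ)} is a bijection between the set of affine Jacobi brackets on C^∞(V,ℝ) and the set of Lie algebra brackets on the vector space Aff(V,ℝ) ≅ V*⊕ℝ. In particular, the restriction of an affine Jacobi bracket to affine functions is a Lie algebra bracket on Aff(V,ℝ), and every Lie algebra bracket on Aff(V,ℝ) is the restriction of a unique affine Jacobi bracket on C^∞(V,ℝ). -/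
/-- A Jacobi bracket on the smooth functions (those satisfying the predicate `S`)
of a space `N`: an ℝ-bilinear antisymmetric bracket satisfying the Jacobi identity
and the generalized Leibniz rule. -/
structure JacobiBracket (N : Type*) (S : (N → ℝ) → Prop) where
  br : (N → ℝ) → (N → ℝ) → N → ℝ
  smooth_br : ∀ f g, S f → S g → S (br f g)
  add_left : ∀ f g h, S f → S g → S h → br (f + g) h = br f h + br g h
  smul_left : ∀ (c : ℝ) (f g : N → ℝ), S f → S g → br (c • f) g = c • br f g
  antisymm : ∀ f g, S f → S g → br f g = -br g f
  jacobi : ∀ f g h, S f → S g → S h →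
    br f (br g h) + br g (br h f) + br h (br f g) = 0
  leibniz : ∀ f g h, S f → S g → S h →
    br f (g * h) = br f g * h + g * br f h - g * h * br f 1

/-- Smooth (C^∞) real functions on a normed space `V`. -/
def Cinf (V : Type*) [NormedAddCommGroup V] [NormedSpace ℝ V] : (V → ℝ) → Prop :=
  fun f => ContDiff ℝ (⊤ : ℕ∞) f

/-- Affine real functions on a real vector space: `x ↦ μ(x) + c` with `μ` linear. -/
def IsAffineFn {V : Type*} [AddCommGroup V] [Module ℝ V] (f : V → ℝ) : Prop :=
  ∃ (μ : V →ₗ[ℝ] ℝ) (c : ℝ), ∀ x, f x = μ x + c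

/-- A Jacobi bracket on `C^∞(V,ℝ)` is affine if the bracket of two affine functions
is affine. -/
def IsAffineJacobi {V : Type*} [NormedAddCommGroup V] [NormedSpace ℝ V]
    (J : JacobiBracket V (Cinf V)) : Prop :=
  ∀ a b, Cinf V a → Cinf V b → IsAffineFn a → IsAffineFn b → IsAffineFn (J.br a b)

/-- A Lie algebra bracket on the space `Aff(V,ℝ) = V →ᵃ[ℝ] ℝ` of affine functions:
ℝ-bilinear, antisymmetric, satisfying the Jacobi identity. -/
def IsLieBracketAff {V : Type*} [NormedAddCommGroup V] [NormedSpace ℝ V]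
    (B : (V →ᵃ[ℝ] ℝ) → (V →ᵃ[ℝ] ℝ) → (V →ᵃ[ℝ] ℝ)) : Prop :=
  (∀ a b c, B (a + b) c = B a c + B b c) ∧
  (∀ (r : ℝ) (a b), B (r • a) b = r • B a b) ∧
  (∀ a b, B a b = -B b a) ∧
  (∀ a b c, B a (B b c) + B b (B c a) + B c (B a b) = 0)

open scoped ContDiff in
/-- The integral over `[0, 1]` of a function depending smoothly on a parameter is smooth. -/
theorem contDiff_integral_unitInterval_nat {H : Type*} [NormedAddCommGroup H] [NormedSpace ℝ H]
    [FiniteDimensional ℝ H] (n : ℕ) {φ : H × ℝ → ℝ} (hφ : ContDiff ℝ ∞ φ) :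
    ContDiff ℝ n (fun x => ∫ t in (0 : ℝ)..1, φ (x, t)) := by
  have hderiv : ∀ ψ : H × ℝ → ℝ, ContDiff ℝ ∞ ψ → ∀ x : H,
      HasFDerivAt (fun x => ∫ t in (0 : ℝ)..1, ψ (x, t))
        (∫ t in (0 : ℝ)..1, (fderiv ℝ ψ (x, t)).comp (ContinuousLinearMap.inl ℝ H ℝ)) x := by
    intro ψ hψ x
    have : ProperSpace H := FiniteDimensional.proper ℝ H
    have hc : Continuous (fun p : H × ℝ =>
        (fderiv ℝ ψ p).comp (ContinuousLinearMap.inl ℝ H ℝ)) :=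
      (hψ.continuous_fderiv (by simp)).clm_comp continuous_const
    obtain ⟨C, hC⟩ := ((isCompact_closedBall x 1).prod
      (isCompact_Icc (a := (0 : ℝ)) (b := 1))).exists_bound_of_continuousOn hc.continuousOn
    refine intervalIntegral.hasFDerivAt_integral_of_dominated_of_fderiv_le
      (F' := fun x t => (fderiv ℝ ψ (x, t)).comp (ContinuousLinearMap.inl ℝ H ℝ))
      (bound := fun _ => C) (Metric.closedBall_mem_nhds x one_pos) ?_ ?_ ?_ ?_ ?_ ?_
    · exact .of_forall fun y =>
        (hψ.continuous.comp (Continuous.prodMk_right y)).aestronglyMeasurable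
    · exact (hψ.continuous.comp (Continuous.prodMk_right x)).intervalIntegrable _ _
    · exact (hc.comp (Continuous.prodMk_right x)).aestronglyMeasurable
    · refine .of_forall fun t ht y hy => hC (y, t) ⟨hy, ?_⟩
      rw [Set.uIoc_of_le zero_le_one] at ht
      exact Set.Ioc_subset_Icc_self ht
    · exact intervalIntegrable_const
    · refine .of_forall fun t _ y _ => ?_
      exact ((hψ.differentiable (by simp)) (y, t)).hasFDerivAt.comp y (hasFDerivAt_prodMk_left y t)
  induction n generalizing φ with
  | zero =>
    exact contDiff_zero.2 (continuous_iff_continuousAt.2 fun x => (hderiv φ hφ x).continuousAt)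
  | succ n ih =>
    rw [Nat.cast_succ, contDiff_succ_iff_fderiv_apply]
    refine ⟨fun x => (hderiv φ hφ x).differentiableAt, by simp, fun y => ?_⟩
    have key : (fun x => fderiv ℝ (fun x => ∫ t in (0 : ℝ)..1, φ (x, t)) x y) =
        fun x => ∫ t in (0 : ℝ)..1, fderiv ℝ φ (x, t) (y, 0) := by
      ext x
      rw [(hderiv φ hφ x).fderiv, ContinuousLinearMap.intervalIntegral_apply]
      · simp
      · refine Continuous.intervalIntegrable ?_ _ _
        exact ((hφ.continuous_fderiv (by simp)).comp
          (Continuous.prodMk_right x)).clm_comp continuous_const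
    rw [key]
    exact ih (φ := fun p => fderiv ℝ φ p (y, 0))
      ((hφ.fderiv_right (m := ∞) (by simp)).clm_apply contDiff_const)

section Smooth

variable {V : Type*} [NormedAddCommGroup V] [NormedSpace ℝ V]

theorem Cinf.one : Cinf V 1 := contDiff_const

theorem Cinf.smul {f : V → ℝ} (c : ℝ) (hf : Cinf V f) : Cinf V (c • f) :=
  ContDiff.const_smul c hf

theorem Cinf.add {f g : V → ℝ} (hf : Cinf V f) (hg : Cinf V g) : Cinf V (f + g) :=
  ContDiff.add hf hg

theorem Cinf.mul {f g : V → ℝ} (hf : Cinf V f) (hg : Cinf V g) : Cinf V (f * g) :=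
  ContDiff.mul hf hg

theorem Cinf.sum {ι : Type*} {s : Finset ι} {u : ι → V → ℝ} (hu : ∀ i, Cinf V (u i)) :
    Cinf V (∑ i ∈ s, u i) := by
  classical
  induction s using Finset.induction_on with
  | empty => exact contDiff_const
  | insert a s ha ih => rw [Finset.sum_insert ha]; exact (hu a).add ih

theorem Cinf.affineMap [FiniteDimensional ℝ V] (a : V →ᵃ[ℝ] ℝ) : Cinf V a := by
  rw [AffineMap.decomp]
  exact (LinearMap.toContinuousLinearMap a.linear).contDiff.add contDiff_const

theorem AffineMap.isAffineFn (a : V →ᵃ[ℝ] ℝ) : IsAffineFn a :=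
  ⟨a.linear, a 0, fun x => congrFun a.decomp x⟩

/-- An affine function in the sense of `IsAffineFn` is the coercion of an affine map. -/
theorem IsAffineFn.exists_affineMap {f : V → ℝ} (hf : IsAffineFn f) :
    ∃ a : V →ᵃ[ℝ] ℝ, f = a := by
  obtain ⟨μ, c, h⟩ := hf
  exact ⟨μ.toAffineMap + AffineMap.const ℝ V c, by ext x; simp [h x]⟩

/-- The affine function `y ↦ μ (y - x)`. -/
def affineFormAt (x : V) (μ : V →ₗ[ℝ] ℝ) : V →ᵃ[ℝ] ℝ :=
  μ.toAffineMap - AffineMap.const ℝ V (μ x)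

@[simp] theorem affineFormAt_apply (x : V) (μ : V →ₗ[ℝ] ℝ) (y : V) :
    affineFormAt x μ y = μ y - μ x := rfl

/-- Hadamard's lemma with respect to a basis of a finite-dimensional space. -/
theorem Cinf.hadamard [FiniteDimensional ℝ V] {ι : Type*} [Fintype ι]
    (b : Module.Basis ι ℝ V) {g : V → ℝ} (hg : Cinf V g) (x : V) :
    ∃ u : ι → V → ℝ, (∀ i, Cinf V (u i)) ∧ (∀ i, u i x = fderiv ℝ g x (b i)) ∧
      g = g x • (1 : V → ℝ) + ∑ i, ⇑(affineFormAt x (b.coord i)) * u i := by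
  have hg' : ContDiff ℝ (⊤ : ℕ∞) (fderiv ℝ g) := ContDiff.fderiv_right hg (by simp)
  refine ⟨fun i y => ∫ t in (0 : ℝ)..1, fderiv ℝ g (x + t • (y - x)) (b i), ?_, ?_, ?_⟩
  · intro i
    refine contDiff_infty.2 fun n => ?_
    refine contDiff_integral_unitInterval_nat n
      (φ := fun p : V × ℝ => fderiv ℝ g (x + p.2 • (p.1 - x)) (b i)) ?_
    exact (hg'.comp (by fun_prop)).clm_apply contDiff_const
  · intro i
    simp
  · ext y
    have hderiv : ∀ t : ℝ, HasDerivAt (fun t : ℝ => g (x + t • (y - x)))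
        (fderiv ℝ g (x + t • (y - x)) (y - x)) t := by
      intro t
      have h1 : HasDerivAt (fun t : ℝ => x + t • (y - x)) (y - x) t := by
        simpa using ((hasDerivAt_id t).smul_const (y - x)).const_add x
      exact ((ContDiff.differentiable hg (by simp))
        (x + t • (y - x))).hasFDerivAt.comp_hasDerivAt t h1
    have hcont : ∀ v, Continuous fun t : ℝ => fderiv ℝ g (x + t • (y - x)) v := fun v =>
      (hg'.continuous.comp (by fun_prop)).clm_apply continuous_const
    have hftc := intervalIntegral.integral_eq_sub_of_hasDerivAt (a := 0) (b := 1)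
      (fun t _ => hderiv t) ((hcont _).intervalIntegrable _ _)
    have hexp : ∀ t : ℝ, fderiv ℝ g (x + t • (y - x)) (y - x) =
        ∑ i, (b.coord i y - b.coord i x) * fderiv ℝ g (x + t • (y - x)) (b i) := by
      intro t
      generalize fderiv ℝ g (x + t • (y - x)) = L
      conv_lhs => rw [← b.sum_repr (y - x)]
      simp [map_sum]
    simp_rw [hexp] at hftc
    rw [intervalIntegral.integral_finsetSum
      (fun i _ => ((hcont _).const_mul _ |>.intervalIntegrable _ _))] at hftc
    simp only [intervalIntegral.integral_const_mul, one_smul, zero_smul, add_zero,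
      add_sub_cancel] at hftc
    simp only [Pi.add_apply, Pi.smul_apply, Pi.one_apply, smul_eq_mul, mul_one,
      Finset.sum_apply, Pi.mul_apply, affineFormAt_apply]
    rw [hftc]
    ring

end Smooth

namespace JacobiBracket

variable {V : Type*} [NormedAddCommGroup V] [NormedSpace ℝ V] (J : JacobiBracket V (Cinf V))

theorem add_right {f g h : V → ℝ} (hf : Cinf V f) (hg : Cinf V g) (hh : Cinf V h) :
    J.br f (g + h) = J.br f g + J.br f h := by
  rw [J.antisymm f _ hf (hg.add hh), J.add_left g h f hg hh hf, J.antisymm g f hg hf,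
    J.antisymm h f hh hf]
  abel

theorem smul_right (c : ℝ) {f g : V → ℝ} (hf : Cinf V f) (hg : Cinf V g) :
    J.br f (c • g) = c • J.br f g := by
  rw [J.antisymm f _ hf (hg.smul c), J.smul_left c g f hg hf, J.antisymm g f hg hf, smul_neg,
    neg_neg]

theorem sum_right {ι : Type*} {s : Finset ι} {f : V → ℝ} {u : ι → V → ℝ} (hf : Cinf V f)
    (hu : ∀ i, Cinf V (u i)) : J.br f (∑ i ∈ s, u i) = ∑ i ∈ s, J.br f (u i) := by
  classical
  induction s using Finset.induction_on with
  | empty => simpa using J.smul_right 0 hf Cinf.one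
  | insert a s ha ih =>
    rw [Finset.sum_insert ha, Finset.sum_insert ha, J.add_right hf (hu a) (Cinf.sum hu), ih]

/-- A Jacobi bracket is a first-order differential operator in its second argument. -/
theorem br_eq_firstOrder [FiniteDimensional ℝ V] {ι : Type*} [Fintype ι]
    (b : Module.Basis ι ℝ V) {f g : V → ℝ} (hf : Cinf V f) (hg : Cinf V g) (x : V) :
    J.br f g x = g x * J.br f 1 x +
      ∑ i, J.br f (affineFormAt x (b.coord i)) x * fderiv ℝ g x (b i) := by
  obtain ⟨u, hu, hux, hgu⟩ := hg.hadamard b x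
  have hl : ∀ i, Cinf V (affineFormAt x (b.coord i)) := fun i => Cinf.affineMap _
  conv_lhs => rw [hgu]
  rw [J.add_right hf (Cinf.one.smul _) (Cinf.sum fun i => (hl i).mul (hu i)),
    J.smul_right _ hf Cinf.one, J.sum_right hf fun i => (hl i).mul (hu i)]
  simp only [Pi.add_apply, Pi.smul_apply, smul_eq_mul, Finset.sum_apply]
  congr 1
  refine Finset.sum_congr rfl fun i _ => ?_
  rw [J.leibniz f _ _ hf (hl i) (hu i)]
  simp [hux]

/-- Two Jacobi brackets agreeing on affine functions coincide on smooth functions. -/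
theorem br_eq_of_affine [FiniteDimensional ℝ V] {J₁ J₂ : JacobiBracket V (Cinf V)}
    (h : ∀ a b : V →ᵃ[ℝ] ℝ, J₁.br ⇑a ⇑b = J₂.br ⇑a ⇑b) {f g : V → ℝ} (hf : Cinf V f)
    (hg : Cinf V g) : J₁.br f g = J₂.br f g := by
  let b := Module.finBasis ℝ V
  have hone : ((AffineMap.const ℝ V (1 : ℝ) : V →ᵃ[ℝ] ℝ) : V → ℝ) = 1 := rfl
  have extend : ∀ u : V → ℝ, Cinf V u → (∀ a : V →ᵃ[ℝ] ℝ, J₁.br u a = J₂.br u a) →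
      ∀ w, Cinf V w → J₁.br u w = J₂.br u w := by
    intro u hu hua w hw
    ext x
    have hu1 : J₁.br u 1 = J₂.br u 1 := hone ▸ hua _
    rw [J₁.br_eq_firstOrder b hu hw, J₂.br_eq_firstOrder b hu hw, hu1]
    simp_rw [hua]
  refine extend f hf (fun a => ?_) g hg
  rw [J₁.antisymm f a hf (Cinf.affineMap a), J₂.antisymm f a hf (Cinf.affineMap a),
    extend a (Cinf.affineMap a) (h a) f hf]

/-- The restriction of an affine Jacobi bracket to affine functions is a Lie bracket. -/
theorem exists_isLieBracketAff [FiniteDimensional ℝ V] (hJ : IsAffineJacobi J) :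
    ∃ B : (V →ᵃ[ℝ] ℝ) → (V →ᵃ[ℝ] ℝ) → (V →ᵃ[ℝ] ℝ),
      (∀ a b : V →ᵃ[ℝ] ℝ, J.br ⇑a ⇑b = ⇑(B a b)) ∧ IsLieBracketAff B := by
  have hS : ∀ a : V →ᵃ[ℝ] ℝ, Cinf V a := Cinf.affineMap
  choose B hB using fun a b : V →ᵃ[ℝ] ℝ =>
    (hJ a b (hS a) (hS b) a.isAffineFn b.isAffineFn).exists_affineMap
  refine ⟨B, hB, fun a b c => ?_, fun r a b => ?_, fun a b => ?_, fun a b c => ?_⟩ <;>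
    apply DFunLike.coe_injective
  · rw [← hB, AffineMap.coe_add, AffineMap.coe_add, J.add_left _ _ _ (hS a) (hS b) (hS c), hB, hB]
  · rw [← hB, AffineMap.coe_smul, AffineMap.coe_smul, J.smul_left _ _ _ (hS a) (hS b), hB]
  · rw [← hB, AffineMap.coe_neg, J.antisymm _ _ (hS a) (hS b), hB]
  · simpa [hB] using J.jacobi a b c (hS a) (hS b) (hS c)

end JacobiBracket

section Jet

variable {V : Type*} [NormedAddCommGroup V] [NormedSpace ℝ V]

/-- The first-order Taylor polynomial of `f` at `x`, as a pair (constant term, linear part). -/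
noncomputable def affineJet (f : V → ℝ) (x : V) : ℝ × (V →L[ℝ] ℝ) :=
  (f x - fderiv ℝ f x x, fderiv ℝ f x)

/-- Evaluation at `x` of the affine function with given constant term and linear part. -/
noncomputable def affineEval (x : V) : ℝ × (V →L[ℝ] ℝ) →L[ℝ] ℝ :=
  ContinuousLinearMap.fst ℝ _ _ +
    (ContinuousLinearMap.apply ℝ ℝ x).comp (ContinuousLinearMap.snd ℝ _ _)

@[simp] theorem affineEval_apply (x : V) (p : ℝ × (V →L[ℝ] ℝ)) :
    affineEval x p = p.1 + p.2 x := rfl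

/-- The affine function vanishing at `x` with given linear part. -/
noncomputable def affineVanishing (x : V) : (V →L[ℝ] ℝ) →L[ℝ] ℝ × (V →L[ℝ] ℝ) :=
  (-(ContinuousLinearMap.apply ℝ ℝ x)).prod (ContinuousLinearMap.id ℝ _)

@[simp] theorem affineVanishing_apply (x : V) (μ : V →L[ℝ] ℝ) :
    affineVanishing x μ = (-μ x, μ) := rfl

theorem Cinf.fderiv {f : V → ℝ} (hf : Cinf V f) : ContDiff ℝ (⊤ : ℕ∞) (fderiv ℝ f) :=
  ContDiff.fderiv_right hf (by simp)

theorem contDiff_affineJet {f : V → ℝ} (hf : Cinf V f) :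
    ContDiff ℝ (⊤ : ℕ∞) (affineJet f) :=
  (ContDiff.sub hf (hf.fderiv.clm_apply contDiff_id)).prodMk hf.fderiv

theorem Cinf.hasFDerivAt {f : V → ℝ} (hf : Cinf V f) (x : V) :
    HasFDerivAt f (_root_.fderiv ℝ f x) x :=
  ((ContDiff.differentiable hf (by simp)) x).hasFDerivAt

theorem hasFDerivAt_affineJet {f : V → ℝ} (hf : Cinf V f) (x : V) :
    HasFDerivAt (affineJet f) ((affineVanishing x).comp (fderiv ℝ (fderiv ℝ f) x)) x := by
  have h2 : HasFDerivAt (fderiv ℝ f) (fderiv ℝ (fderiv ℝ f) x) x :=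
    ((hf.fderiv.differentiable (by simp)) x).hasFDerivAt
  refine (((hf.hasFDerivAt x).sub (h2.clm_apply (hasFDerivAt_id x))).prodMk h2).congr_fderiv ?_
  ext v <;> simp

theorem affineJet_add {f g : V → ℝ} (hf : Cinf V f) (hg : Cinf V g) (x : V) :
    affineJet (f + g) x = affineJet f x + affineJet g x := by
  have h := ((hf.hasFDerivAt x).add (hg.hasFDerivAt x)).fderiv
  ext <;> simp [affineJet, h]
  ring

theorem affineJet_smul {f : V → ℝ} (c : ℝ) (hf : Cinf V f) (x : V) :
    affineJet (c • f) x = c • affineJet f x := by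
  have h := ((hf.hasFDerivAt x).const_smul c).fderiv
  ext <;> simp [affineJet, h]
  ring

theorem affineJet_one (x : V) : affineJet 1 x = (1, 0) := by
  have h : fderiv ℝ (1 : V → ℝ) x = 0 := (hasFDerivAt_const (1 : ℝ) x).fderiv
  simp [affineJet, h]

theorem affineJet_mul {f g : V → ℝ} (hf : Cinf V f) (hg : Cinf V g) (x : V) :
    affineJet (f * g) x = g x • affineJet f x + f x • affineJet g x
      - (f x * g x) • affineJet 1 x := by
  have h := ((hf.hasFDerivAt x).mul (hg.hasFDerivAt x)).fderiv
  rw [affineJet_one]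
  ext <;> simp [affineJet, h] <;> ring

variable (b : ℝ × (V →L[ℝ] ℝ) →L[ℝ] ℝ × (V →L[ℝ] ℝ) →L[ℝ] ℝ × (V →L[ℝ] ℝ))

/-- The bracket on functions induced by a bilinear operation on affine functions, by applying
the operation to first-order Taylor polynomials. -/
noncomputable def jetBracket (f g : V → ℝ) (x : V) : ℝ :=
  affineEval x (b (affineJet f x) (affineJet g x))

theorem cinf_jetBracket {f g : V → ℝ} (hf : Cinf V f) (hg : Cinf V g) :
    Cinf V (jetBracket b f g) := by
  have hjf := contDiff_affineJet hf
  have hjg := contDiff_affineJet hg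
  have h : ContDiff ℝ (⊤ : ℕ∞) fun x => b (affineJet f x) (affineJet g x) := by fun_prop
  exact h.fst.add (h.snd.clm_apply contDiff_id)

theorem exists_hamiltonianVector [FiniteDimensional ℝ V] (f : V → ℝ) (x : V) :
    ∃ X : V, ∀ μ : V →L[ℝ] ℝ,
      affineEval x (b (affineJet f x) (affineVanishing x μ)) = μ X := by
  let L : Module.Dual ℝ (Module.Dual ℝ V) :=
    (((affineEval x).comp (b (affineJet f x))).comp (affineVanishing x)).toLinearMap ∘ₗ
      LinearMap.toContinuousLinearMap.toLinearMap
  refine ⟨(Module.evalEquiv ℝ V).symm L, fun μ => ?_⟩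
  have h := Module.apply_evalEquiv_symm_apply ℝ V (μ : V →ₗ[ℝ] ℝ) L
  exact h.symm

/-- The Taylor polynomial of the bracket is the bracket of the Taylor polynomials, up to a
correction involving second derivatives. -/
theorem affineJet_jetBracket (hb : ∀ p q, b p q = -b q p) {f g : V → ℝ} (hf : Cinf V f)
    (hg : Cinf V g) {x X Y : V}
    (hX : ∀ μ : V →L[ℝ] ℝ, affineEval x (b (affineJet f x) (affineVanishing x μ)) = μ X)
    (hY : ∀ μ : V →L[ℝ] ℝ, affineEval x (b (affineJet g x) (affineVanishing x μ)) = μ Y) :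
    affineJet (jetBracket b f g) x = b (affineJet f x) (affineJet g x) +
      affineVanishing x ((ContinuousLinearMap.apply ℝ ℝ X).comp (fderiv ℝ (fderiv ℝ g) x) -
        (ContinuousLinearMap.apply ℝ ℝ Y).comp (fderiv ℝ (fderiv ℝ f) x)) := by
  have h := b.hasFDerivAt_of_bilinear (hasFDerivAt_affineJet hf x) (hasFDerivAt_affineJet hg x)
  have h' := h.fst.add (h.snd.clm_apply (hasFDerivAt_id x))
  have hd : fderiv ℝ (jetBracket b f g) x = (b (affineJet f x) (affineJet g x)).2 +
      ((ContinuousLinearMap.apply ℝ ℝ X).comp (fderiv ℝ (fderiv ℝ g) x) -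
        (ContinuousLinearMap.apply ℝ ℝ Y).comp (fderiv ℝ (fderiv ℝ f) x)) := by
    refine (HasFDerivAt.fderiv (f := jetBracket b f g) h').trans ?_
    ext v
    have h1 := hX (fderiv ℝ (fderiv ℝ g) x v)
    have h2 := hY (fderiv ℝ (fderiv ℝ f) x v)
    rw [hb] at h2
    simp at h1 h2 ⊢
    linarith
  ext v
  · simp [affineJet, hd, jetBracket]
    ring
  · simp [affineJet, hd]

theorem jetBracket_jacobi [FiniteDimensional ℝ V] (hb : ∀ p q, b p q = -b q p)
    (hJ : ∀ p q r, b p (b q r) + b q (b r p) + b r (b p q) = 0)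
    {f g h : V → ℝ} (hf : Cinf V f) (hg : Cinf V g) (hh : Cinf V h) :
    jetBracket b f (jetBracket b g h) + jetBracket b g (jetBracket b h f) +
      jetBracket b h (jetBracket b f g) = 0 := by
  ext x
  obtain ⟨X, hX⟩ := exists_hamiltonianVector b f x
  obtain ⟨Y, hY⟩ := exists_hamiltonianVector b g x
  obtain ⟨Z, hZ⟩ := exists_hamiltonianVector b h x
  have symm : ∀ u : V → ℝ, Cinf V u → ∀ v w,
      fderiv ℝ (fderiv ℝ u) x v w = fderiv ℝ (fderiv ℝ u) x w v := fun u hu v w =>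
    (ContDiff.contDiffAt hu).isSymmSndFDerivAt (by
      simpa using (WithTop.coe_le_coe.2 le_top : ((2 : ℕ∞) : WithTop ℕ∞) ≤ (⊤ : ℕ∞))) v w
  have key := congrArg (affineEval x) (hJ (affineJet f x) (affineJet g x) (affineJet h x))
  rw [map_add, map_add, map_zero] at key
  simp only [Pi.add_apply, Pi.zero_apply]
  rw [jetBracket, affineJet_jetBracket b hb hg hh hY hZ, jetBracket,
    affineJet_jetBracket b hb hh hf hZ hX, jetBracket, affineJet_jetBracket b hb hf hg hX hY,
    map_add, map_add, map_add, map_add, map_add, map_add, hX, hY, hZ]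
  simp only [sub_apply, ContinuousLinearMap.comp_apply,
    ContinuousLinearMap.apply_apply]
  rw [symm f hf Y Z, symm g hg X Z, symm h hh X Y]
  linarith

/-- The Jacobi bracket induced by a Lie bracket on affine functions. -/
noncomputable def jetJacobiBracket [FiniteDimensional ℝ V] (hb : ∀ p q, b p q = -b q p)
    (hJ : ∀ p q r, b p (b q r) + b q (b r p) + b r (b p q) = 0) :
    JacobiBracket V (Cinf V) where
  br := jetBracket b
  smooth_br _ _ := cinf_jetBracket b
  add_left f g h hf hg _ := by
    ext x
    simp only [jetBracket, affineJet_add hf hg, map_add, add_apply,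
      Pi.add_apply]
  smul_left c f g hf _ := by
    ext x
    simp only [jetBracket, affineJet_smul c hf, map_smul, smul_apply,
      Pi.smul_apply]
  antisymm f g _ _ := by
    ext x
    rw [jetBracket, hb, map_neg]
    rfl
  jacobi _ _ _ := jetBracket_jacobi b hb hJ
  leibniz f g h _ hg hh := by
    ext x
    simp only [jetBracket, affineJet_mul hg hh, map_add, map_sub, map_smul, Pi.add_apply,
      Pi.sub_apply, Pi.mul_apply, smul_eq_mul]
    ring

/-- Affine functions as pairs (constant term, linear part). -/
noncomputable def affineMapEquiv [FiniteDimensional ℝ V] :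
    (V →ᵃ[ℝ] ℝ) ≃ₗ[ℝ] ℝ × (V →L[ℝ] ℝ) :=
  (AffineMap.toConstProdLinearMap ℝ).trans
    ((LinearEquiv.refl ℝ ℝ).prodCongr LinearMap.toContinuousLinearMap)

theorem affineEval_affineMapEquiv [FiniteDimensional ℝ V] (a : V →ᵃ[ℝ] ℝ) (x : V) :
    affineEval x (affineMapEquiv a) = a x := by
  rw [a.decomp]
  exact add_comm _ _

theorem affineJet_affineMap [FiniteDimensional ℝ V] (a : V →ᵃ[ℝ] ℝ) (x : V) :
    affineJet a x = affineMapEquiv a := by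
  have h : HasFDerivAt a (LinearMap.toContinuousLinearMap a.linear) x := by
    rw [AffineMap.decomp]
    exact (LinearMap.toContinuousLinearMap a.linear).hasFDerivAt.add_const _
  have hx := congrFun a.decomp x
  simp at hx
  ext v
  · simp [affineJet, h.fderiv, affineMapEquiv, hx]
  · simp [affineJet, h.fderiv, affineMapEquiv]

/-- Every Lie bracket on affine functions is the restriction of an affine Jacobi bracket. -/
theorem IsLieBracketAff.exists_jacobiBracket [FiniteDimensional ℝ V]
    {B : (V →ᵃ[ℝ] ℝ) → (V →ᵃ[ℝ] ℝ) → (V →ᵃ[ℝ] ℝ)} (hB : IsLieBracketAff B) :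
    ∃ J : JacobiBracket V (Cinf V), IsAffineJacobi J ∧
      ∀ a b : V →ᵃ[ℝ] ℝ, J.br ⇑a ⇑b = ⇑(B a b) := by
  obtain ⟨hadd, hsmul, hanti, hjac⟩ := hB
  let e := affineMapEquiv (V := V)
  let b : ℝ × (V →L[ℝ] ℝ) →L[ℝ] ℝ × (V →L[ℝ] ℝ) →L[ℝ] ℝ × (V →L[ℝ] ℝ) :=
    (LinearMap.mk₂ ℝ (fun p q => e (B (e.symm p) (e.symm q)))
      (fun p q r => by simp [hadd])
      (fun c p q => by simp [hsmul])
      (fun p q r => by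
        rw [hanti, map_add, hadd, hanti (e.symm q), hanti (e.symm r)]
        simp [add_comm])
      (fun c p q => by
        rw [hanti, map_smul, hsmul, hanti (e.symm q)]
        simp)).toContinuousBilinearMap
  have hbe : ∀ p q, b p q = e (B (e.symm p) (e.symm q)) := fun _ _ => rfl
  have hb : ∀ p q, b p q = -b q p := fun p q => by
    rw [hbe, hbe, hanti, map_neg]
  have hJ : ∀ p q r, b p (b q r) + b q (b r p) + b r (b p q) = 0 := fun p q r => by
    simp only [hbe, LinearEquiv.symm_apply_apply, ← map_add, hjac, map_zero]
  have hres : ∀ a c : V →ᵃ[ℝ] ℝ, (jetJacobiBracket b hb hJ).br a c = B a c := fun a c => by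
    ext x
    change affineEval x (b (affineJet a x) (affineJet c x)) = _
    rw [affineJet_affineMap, affineJet_affineMap, hbe, LinearEquiv.symm_apply_apply,
      LinearEquiv.symm_apply_apply, affineEval_affineMapEquiv]
  refine ⟨jetJacobiBracket b hb hJ, fun f g _ _ hf hg => ?_, hres⟩
  obtain ⟨a, rfl⟩ := hf.exists_affineMap
  obtain ⟨c, rfl⟩ := hg.exists_affineMap
  rw [hres]
  exact (B a c).isAffineFn

end Jet

/-- for a finite-dimensional real vector space `V` of positive dimension,
restriction to affine functions is a bijection between affine Jacobi brackets on
`C^∞(V,ℝ)` and Lie algebra brackets on `Aff(V,ℝ)`: the restriction of an affine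
Jacobi bracket to affine functions is a Lie algebra bracket on `Aff(V,ℝ)`, every
Lie algebra bracket on `Aff(V,ℝ)` is the restriction of an affine Jacobi bracket,
and two affine Jacobi brackets with the same restriction coincide. -/
theorem stmt5 (V : Type*) [NormedAddCommGroup V] [NormedSpace ℝ V]
    [FiniteDimensional ℝ V] (hV : 0 < Module.finrank ℝ V) :
    -- the restriction of an affine Jacobi bracket is a Lie algebra bracket on Aff(V,ℝ)
    (∀ J : JacobiBracket V (Cinf V), IsAffineJacobi J →
      ∃ B : (V →ᵃ[ℝ] ℝ) → (V →ᵃ[ℝ] ℝ) → (V →ᵃ[ℝ] ℝ),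
        (∀ a b : V →ᵃ[ℝ] ℝ, J.br ⇑a ⇑b = ⇑(B a b)) ∧ IsLieBracketAff B) ∧
    -- surjectivity: every Lie algebra bracket on Aff(V,ℝ) is a restriction
    (∀ B : (V →ᵃ[ℝ] ℝ) → (V →ᵃ[ℝ] ℝ) → (V →ᵃ[ℝ] ℝ), IsLieBracketAff B →
      ∃ J : JacobiBracket V (Cinf V), IsAffineJacobi J ∧
        ∀ a b : V →ᵃ[ℝ] ℝ, J.br ⇑a ⇑b = ⇑(B a b)) ∧
    -- injectivity: an affine Jacobi bracket is determined by its restriction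
    (∀ J₁ J₂ : JacobiBracket V (Cinf V), IsAffineJacobi J₁ → IsAffineJacobi J₂ →
      (∀ a b : V →ᵃ[ℝ] ℝ, J₁.br ⇑a ⇑b = J₂.br ⇑a ⇑b) →
      ∀ f g, Cinf V f → Cinf V g → J₁.br f g = J₂.br f g) := by
  exact ⟨fun J hJ => J.exists_isLieBracketAff hJ, fun _ hB => hB.exists_jacobiBracket,
    fun _ _ _ _ h _ _ hf hg => JacobiBracket.br_eq_of_affine h hf hg⟩
end

section
/- Let V be a finite-dimensional real vector space with dim V > 0 and let {·,·} be an affine Jacobi bracket on C^∞(V,ℝ). Then {1,f} = 0 for all f ∈ C^∞(V,ℝ) (equivalently, {·,·} is a Poisson bracket, i.e. satisfies the ordinary Leibniz rule {f,g·h} = {f,g}·h + g·{f,h}) if and only if {1,a} = 0 for every affine function a, i.e. if and only if the constant function 1 is a central element of the Lie algebra obtained by restricting the bracket to Aff(V,ℝ). (This gives the bijection between affine Poisson structures on V and Lie algebra structures on Aff(V,ℝ) in which 1 is central, i.e. central extensions of Lie algebra structures on V*.) -/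
open MeasureTheory Set Filter Topology

/-- Differentiation under the integral sign for a `C^1` integrand on `V × [0, 1]`. -/
theorem hasFDerivAt_integral_unitInterval_of_contDiff {V E : Type*}
    [NormedAddCommGroup V] [NormedSpace ℝ V] [FiniteDimensional ℝ V]
    [NormedAddCommGroup E] [NormedSpace ℝ E]
    {F : V × ℝ → E} (hF : ContDiff ℝ 1 F) (x₀ : V) :
    HasFDerivAt (fun x => ∫ t in (0 : ℝ)..1, F (x, t))
      (∫ t in (0 : ℝ)..1, (fderiv ℝ F (x₀, t)).comp (ContinuousLinearMap.inl ℝ V ℝ)) x₀ := by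
  have hcont : Continuous fun q : V × ℝ =>
      (fderiv ℝ F q).comp (ContinuousLinearMap.inl ℝ V ℝ) :=
    (hF.continuous_fderiv one_ne_zero).clm_comp continuous_const
  have hFc := hF.continuous
  have : ProperSpace V := FiniteDimensional.proper ℝ V
  obtain ⟨C, hC⟩ := ((isCompact_closedBall x₀ 1).prod
    (isCompact_Icc (a := (0 : ℝ)) (b := 1))).exists_bound_of_continuousOn hcont.continuousOn
  refine intervalIntegral.hasFDerivAt_integral_of_dominated_of_fderiv_le
    (F' := fun x t => (fderiv ℝ F (x, t)).comp (ContinuousLinearMap.inl ℝ V ℝ))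
    (bound := fun _ => C)
    (Metric.closedBall_mem_nhds x₀ one_pos) ?_ ?_ ?_ ?_ ?_ ?_
  · exact Eventually.of_forall fun x =>
      (by fun_prop : Continuous fun t => F (x, t)).aestronglyMeasurable
  · exact (by fun_prop : Continuous fun t => F (x₀, t)).intervalIntegrable _ _
  · exact (hcont.comp (by fun_prop : Continuous fun t : ℝ => (x₀, t))).aestronglyMeasurable
  · refine Eventually.of_forall fun t ht x hx => hC (x, t) ⟨hx, ?_⟩
    rw [uIoc_of_le zero_le_one] at ht
    exact Ioc_subset_Icc_self ht
  · exact intervalIntegrable_const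
  · refine Eventually.of_forall fun t _ x _ => ?_
    exact ((hF.differentiable one_ne_zero) (x, t)).hasFDerivAt.comp x
      (hasFDerivAt_prodMk_left x t)

/-- An integral over `[0, 1]` of a `C^n` function depends in a `C^n` way on parameters. -/
theorem contDiff_nat_integral_unitInterval.{u} {V : Type u}
    [NormedAddCommGroup V] [NormedSpace ℝ V] [FiniteDimensional ℝ V] (n : ℕ) :
    ∀ {E : Type u} [NormedAddCommGroup E] [NormedSpace ℝ E] {F : V × ℝ → E},
      ContDiff ℝ n F → ContDiff ℝ n fun x : V => ∫ t in (0 : ℝ)..1, F (x, t) := by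
  induction n with
  | zero =>
    intro E _ _ F hF
    simp only [Nat.cast_zero, contDiff_zero] at hF ⊢
    exact intervalIntegral.continuous_parametric_intervalIntegral_of_continuous' (by fun_prop) 0 1
  | succ n ih =>
    intro E _ _ F hF
    have hd := hasFDerivAt_integral_unitInterval_of_contDiff (F := F)
      (hF.of_le (by exact_mod_cast Nat.succ_le_succ n.zero_le) : ContDiff ℝ 1 F)
    push_cast at hF ⊢
    rw [contDiff_succ_iff_fderiv] at hF ⊢
    refine ⟨fun x => (hd x).differentiableAt, by simp, ?_⟩
    rw [funext fun x => (hd x).fderiv]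
    have hF' : ContDiff ℝ n fun q : V × ℝ =>
        (fderiv ℝ F q).comp (ContinuousLinearMap.inl ℝ V ℝ) :=
      hF.2.2.clm_comp contDiff_const
    exact ih hF'

/-- **Hadamard's lemma**: a smooth function is `f p + g x (x - p)` with `g` smooth. -/
theorem exists_contDiff_hadamard {V : Type*}
    [NormedAddCommGroup V] [NormedSpace ℝ V] [FiniteDimensional ℝ V]
    {f : V → ℝ} (hf : ContDiff ℝ (⊤ : ℕ∞) f) (p : V) :
    ∃ g : V → V →L[ℝ] ℝ, ContDiff ℝ (⊤ : ℕ∞) g ∧ ∀ x, f x = f p + g x (x - p) := by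
  have hf' : ContDiff ℝ (⊤ : ℕ∞) (fderiv ℝ f) := (contDiff_infty_iff_fderiv.1 hf).2
  have hF : ContDiff ℝ (⊤ : ℕ∞) fun q : V × ℝ => fderiv ℝ f (p + q.2 • (q.1 - p)) :=
    hf'.comp (by fun_prop)
  refine ⟨fun x => ∫ t in (0 : ℝ)..1, fderiv ℝ f (p + t • (x - p)), ?_, fun x => ?_⟩
  · exact contDiff_infty.2 fun n =>
      contDiff_nat_integral_unitInterval n (contDiff_infty.1 hF n)
  · have hc : Continuous fun t : ℝ => fderiv ℝ f (p + t • (x - p)) :=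
      hF.continuous.comp (by fun_prop : Continuous fun t : ℝ => (x, t))
    have hderiv : ∀ t ∈ uIcc (0 : ℝ) 1, HasDerivAt (fun t : ℝ => f (p + t • (x - p)))
        (fderiv ℝ f (p + t • (x - p)) (x - p)) t := fun t _ => by
      have hline : HasDerivAt (fun t : ℝ => p + t • (x - p)) (x - p) t := by
        simpa using ((hasDerivAt_id t).smul_const (x - p)).const_add p
      exact ((hf.differentiable (by simp)) _).hasFDerivAt.comp_hasDerivAt t hline
    have hint := intervalIntegral.integral_eq_sub_of_hasDerivAt hderiv
      ((hc.clm_apply continuous_const).intervalIntegrable _ _)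
    rw [ContinuousLinearMap.intervalIntegral_apply (hc.intervalIntegrable _ _), hint]
    simp

/-- A derivation of the algebra of smooth functions vanishing on affine functions is zero. -/
theorem derivation_eq_zero_of_affine {V : Type*}
    [NormedAddCommGroup V] [NormedSpace ℝ V] [FiniteDimensional ℝ V]
    (D : (V → ℝ) → V → ℝ)
    (hadd : ∀ f g, Cinf V f → Cinf V g → D (f + g) = D f + D g)
    (hmul : ∀ f g, Cinf V f → Cinf V g → D (f * g) = D f * g + f * D g)
    (haff : ∀ a, Cinf V a → IsAffineFn a → D a = 0)
    {f : V → ℝ} (hf : Cinf V f) : D f = 0 := by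
  funext p
  obtain ⟨g, hg, hfg⟩ := exists_contDiff_hadamard hf p
  let b := Module.finBasis ℝ V
  let a : Fin (Module.finrank ℝ V) → V → ℝ := fun i x => b.coord i (x - p)
  let c : Fin (Module.finrank ℝ V) → V → ℝ := fun i x => g x (b i)
  have ha : ∀ i, Cinf V (a i) := fun i =>
    (b.coord i).toContinuousLinearMap.contDiff.comp (contDiff_id.sub contDiff_const)
  have hc : ∀ i, Cinf V (c i) := fun i => hg.clm_apply contDiff_const
  have ha' : ∀ i, IsAffineFn (a i) := fun i =>
    ⟨b.coord i, -b.coord i p, fun x => by simp [a, sub_eq_add_neg]⟩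
  have hconst : ∀ k : ℝ, D (fun _ => k) = 0 := fun k =>
    haff _ contDiff_const ⟨0, k, by simp⟩
  have hac : ∀ i, Cinf V (a i * c i) := fun i => ContDiff.mul (ha i) (hc i)
  have hsmooth : ∀ s : Finset (Fin (Module.finrank ℝ V)), Cinf V (∑ i ∈ s, a i * c i) :=
    fun s => by
      induction s using Finset.induction_on with
      | empty => exact contDiff_const
      | insert i s hi ih => rw [Finset.sum_insert hi]; exact ContDiff.add (hac i) ih
  have hsum : ∀ s : Finset (Fin (Module.finrank ℝ V)), D (∑ i ∈ s, a i * c i) p = 0 :=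
    fun s => by
      induction s using Finset.induction_on with
      | empty => exact congrFun (hconst 0) p
      | insert i s hi ih =>
        rw [Finset.sum_insert hi, hadd _ _ (hac i) (hsmooth s), Pi.add_apply, ih,
          hmul _ _ (ha i) (hc i), haff _ (ha i) (ha' i)]
        simp [a]
  have hdecomp : f = (fun _ => f p) + ∑ i, a i * c i := by
    funext x
    rw [hfg x, Pi.add_apply]
    congr 1
    conv_lhs => rw [← b.sum_repr (x - p)]
    simp [a, c, Finset.sum_apply]
  rw [hdecomp, hadd _ _ contDiff_const (hsmooth _), hconst, Pi.add_apply, hsum]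
  simp


/-- for an affine Jacobi bracket on `C^∞(V,ℝ)` with `V` finite-dimensional
of positive dimension, `{1,f} = 0` for all smooth `f` (equivalently: the bracket is
Poisson, i.e. satisfies the ordinary Leibniz rule) if and only if `{1,a} = 0` for every
affine function `a` (i.e. the constant function `1` is central in the Lie algebra of
affine functions). -/
theorem stmt6 (V : Type*) [NormedAddCommGroup V] [NormedSpace ℝ V]
    [FiniteDimensional ℝ V] (hV : 0 < Module.finrank ℝ V)
    (J : JacobiBracket V (Cinf V)) (hJ : IsAffineJacobi J) :
    -- {1,·} = 0 iff 1 is central among affine functions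
    ((∀ f, Cinf V f → J.br 1 f = 0) ↔
      (∀ a, Cinf V a → IsAffineFn a → J.br 1 a = 0)) ∧
    -- {1,·} = 0 iff the bracket satisfies the ordinary Leibniz rule (is Poisson)
    ((∀ f, Cinf V f → J.br 1 f = 0) ↔
      (∀ f g h, Cinf V f → Cinf V g → Cinf V h →
        J.br f (g * h) = J.br f g * h + g * J.br f h)) := by
  have h1 : Cinf V 1 := contDiff_const
  have h11 : J.br 1 1 = 0 := self_eq_neg.1 (J.antisymm 1 1 h1 h1)
  refine ⟨⟨fun h a ha _ => h a ha, fun h f hf => ?_⟩, fun h f g k hf hg hk => ?_,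
    fun h f hf => ?_⟩
  · refine derivation_eq_zero_of_affine (J.br 1) (fun f g hf hg => ?_) (fun f g hf hg => ?_) h hf
    · rw [J.antisymm 1 (f + g) h1 (ContDiff.add hf hg), J.add_left _ _ _ hf hg h1,
        J.antisymm _ _ h1 hf, J.antisymm _ _ h1 hg, neg_add]
    · rw [J.leibniz _ _ _ h1 hf hg, h11, mul_zero, sub_zero]
  · rw [J.leibniz _ _ _ hf hg hk, J.antisymm _ _ hf h1, h f hf]
    simp
  · have key := h f 1 1 hf h1 h1
    simp only [mul_one, one_mul, left_eq_add] at key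
    rw [J.antisymm _ _ h1 hf, key, neg_zero]
end
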